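/- arXiv:2602.01650 — 2 statements merged into one kernel-verified Lean document; each statement's English description precedes it below -/
import Mathlib

section
/- The images in L(m,n) of the irreducible words over X form a K-linear basis of L(m,n). -/
open scoped BigOperators

/-- Generators of the Leavitt algebra `L(m,n)`: `Sum.inl (i,j)` is the x-letter `x_{ij}`
(`1 ≤ i ≤ m`, `1 ≤ j ≤ n`, written 0-indexed), and `Sum.inr (j,i)` is the y-letter `y_{ji}`. -/
abbrev LGen (m n : ℕ) := (Fin m × Fin n) ⊕ (Fin n × Fin m)

/-- The defining relations of the Leavitt algebra `L(m,n)`: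
`∑_j x_{ij} y_{ji'} = δ_{i,i'}` and `∑_i y_{ji} x_{ij'} = δ_{j,j'}`. -/
inductive LRel (K : Type) [Field K] (m n : ℕ) :
    FreeAlgebra K (LGen m n) → FreeAlgebra K (LGen m n) → Prop
  | xy (i i' : Fin m) :
      LRel K m n
        (∑ j : Fin n, FreeAlgebra.ι K (Sum.inl (i, j)) * FreeAlgebra.ι K (Sum.inr (j, i')))
        (if i = i' then 1 else 0)
  | yx (j j' : Fin n) :
      LRel K m n
        (∑ i : Fin m, FreeAlgebra.ι K (Sum.inr (j, i)) * FreeAlgebra.ι K (Sum.inl (i, j')))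
        (if j = j' then 1 else 0)

/-- The Leavitt algebra `L(m,n)`, presented by the generators `x_{ij}, y_{ji}` and the
relations `∑_j x_{ij} y_{ji'} = δ_{i,i'}`, `∑_i y_{ji} x_{ij'} = δ_{j,j'}`. -/
abbrev Leavitt (K : Type) [Field K] (m n : ℕ) := RingQuot (LRel K m n)

/-- The image of a generator in `L(m,n)`. -/
noncomputable def lgen (K : Type) [Field K] {m n : ℕ} (z : LGen m n) : Leavitt K m n :=
  RingQuot.mkAlgHom K (LRel K m n) (FreeAlgebra.ι K z)

/-- The generator `x_{ij}` of `L(m,n)` (0-indexed). -/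
noncomputable def xg (K : Type) [Field K] {m n : ℕ} (i : Fin m) (j : Fin n) : Leavitt K m n :=
  lgen K (Sum.inl (i, j))

/-- The generator `y_{ji}` of `L(m,n)` (0-indexed). -/
noncomputable def yg (K : Type) [Field K] {m n : ℕ} (j : Fin n) (i : Fin m) : Leavitt K m n :=
  lgen K (Sum.inr (j, i))

/-- A word over the generating set `X` of `L(m,n)`. -/
abbrev LWord (m n : ℕ) := List (LGen m n)

/-- The image of a word in `L(m,n)` (product of the images of its letters). -/
noncomputable def wordToL (K : Type) [Field K] {m n : ℕ} (w : LWord m n) : Leavitt K m n :=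
  (w.map (lgen K)).prod

/-- A word is balanced if it has equally many x-letters and y-letters. -/
def LWord.Balanced {m n : ℕ} (w : LWord m n) : Prop :=
  w.countP Sum.isLeft = w.countP Sum.isRight

/-- The degree of a word: number of x-letters minus number of y-letters. -/
def LWord.degree {m n : ℕ} (w : LWord m n) : ℤ :=
  (w.countP Sum.isLeft : ℤ) - (w.countP Sum.isRight : ℤ)

/-- The `k`-component of the canonical grading of `L(m,n)`: the `K`-linear span of the
images of all words of degree `k`. -/
noncomputable def Lcomponent (K : Type) [Field K] (m n : ℕ) (k : ℤ) :
    Submodule K (Leavitt K m n) :=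
  Submodule.span K {a | ∃ w : LWord m n, w.degree = k ∧ wordToL K w = a}

/-- A pair of consecutive letters is forbidden if it is of the form `x_{in} y_{ni'}` or
`y_{jm} x_{mj'}` (the second index of the first letter being maximal). -/
def LForbidden {m n : ℕ} (z z' : LGen m n) : Prop :=
  (∃ (i i' : Fin m) (j : Fin n), (j : ℕ) = n - 1 ∧ z = Sum.inl (i, j) ∧ z' = Sum.inr (j, i')) ∨
  (∃ (j j' : Fin n) (i : Fin m), (i : ℕ) = m - 1 ∧ z = Sum.inr (j, i) ∧ z' = Sum.inl (i, j'))

/-- A word is irreducible if it contains no forbidden subword `x_{in} y_{ni'}` or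
`y_{jm} x_{mj'}`. -/
def LWord.Irr {m n : ℕ} (w : LWord m n) : Prop :=
  ∀ (u v : LWord m n) (z z' : LGen m n), w = u ++ z :: z' :: v → ¬ LForbidden z z'

/-- A nonempty balanced word is prime if it is not the concatenation of two nonempty
balanced words. -/
def LWord.IsPrime {m n : ℕ} (w : LWord m n) : Prop :=
  w ≠ [] ∧ w.Balanced ∧ ∀ u v : LWord m n, w = u ++ v → u ≠ [] → v ≠ [] → ¬ u.Balanced

/-- An xy word: a nonempty balanced word whose first letter is an x-letter and whose
last letter is a y-letter. -/
def LWord.XY {m n : ℕ} (w : LWord m n) : Prop :=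
  w.Balanced ∧ (∃ p, w.head? = some (Sum.inl p)) ∧ (∃ q, w.getLast? = some (Sum.inr q))

/-- A yx word: a nonempty balanced word whose first letter is a y-letter and whose
last letter is an x-letter. -/
def LWord.YX {m n : ℕ} (w : LWord m n) : Prop :=
  w.Balanced ∧ (∃ q, w.head? = some (Sum.inr q)) ∧ (∃ p, w.getLast? = some (Sum.inl p))

/-- Membership in the submonoid `⟨X⟩₀^{xy}` of `⟨X⟩₀` generated by the prime xy words. -/
def LWord.InXY {m n : ℕ} (w : LWord m n) : Prop :=
  ∃ ws : List (LWord m n), (∀ u ∈ ws, u.IsPrime ∧ u.XY) ∧ ws.flatten = w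

/-- Membership in the submonoid `⟨X⟩₀^{yx}` of `⟨X⟩₀` generated by the prime yx words. -/
def LWord.InYX {m n : ℕ} (w : LWord m n) : Prop :=
  ∃ ws : List (LWord m n), (∀ u ∈ ws, u.IsPrime ∧ u.YX) ∧ ws.flatten = w

/-- The subalgebra `L(m,n)₀^{xy}` of `L(m,n)` generated by images of all prime xy words. -/
noncomputable def L0xy (K : Type) [Field K] (m n : ℕ) : Subalgebra K (Leavitt K m n) :=
  Algebra.adjoin K {a | ∃ w : LWord m n, w.IsPrime ∧ w.XY ∧ wordToL K w = a}

/-- The subalgebra `L(m,n)₀^{yx}` of `L(m,n)` generated by images of all prime yx words. -/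
noncomputable def L0yx (K : Type) [Field K] (m n : ℕ) : Subalgebra K (Leavitt K m n) :=
  Algebra.adjoin K {a | ∃ w : LWord m n, w.IsPrime ∧ w.YX ∧ wordToL K w = a}

/-- The zero component `L(m,n)₀`, as a subalgebra: it is generated (indeed spanned)
by the images of all balanced words. -/
noncomputable def L0 (K : Type) [Field K] (m n : ℕ) : Subalgebra K (Leavitt K m n) :=
  Algebra.adjoin K {a | ∃ w : LWord m n, w.Balanced ∧ wordToL K w = a}

namespace Leavitt

variable {K : Type} [Field K] {m n : ℕ}

theorem irr_iff_isChain {w : LWord m n} :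
    w.Irr ↔ List.IsChain (fun z z' => ¬ LForbidden z z') w := by
  rw [List.isChain_iff_forall_rel_of_append_cons_cons]
  exact ⟨fun h a b u v e => h u v a b e, fun h u v a b e => h e⟩

theorem irr_nil : LWord.Irr ([] : LWord m n) := by
  simp [irr_iff_isChain]

theorem irr_cons_cons {z z' : LGen m n} {w : LWord m n} :
    LWord.Irr (z :: z' :: w) ↔ ¬ LForbidden z z' ∧ LWord.Irr (z' :: w) := by
  simp only [irr_iff_isChain, List.isChain_cons_cons]

theorem irr_tail {z : LGen m n} {w : LWord m n} (h : LWord.Irr (z :: w)) : w.Irr := by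
  rw [irr_iff_isChain] at h ⊢
  exact h.tail

theorem irr_singleton (z : LGen m n) : LWord.Irr [z] := by
  simp [irr_iff_isChain]

@[simp] theorem forbidden_inl_inr {i i' : Fin m} {j j' : Fin n} :
    LForbidden (Sum.inl (i, j)) (Sum.inr (j', i')) ↔ (j : ℕ) = n - 1 ∧ j' = j := by
  constructor
  · rintro (⟨_, _, _, h, e, e'⟩ | ⟨_, _, _, _, e, _⟩) <;> simp_all
  · rintro ⟨h, rfl⟩
    exact Or.inl ⟨i, i', _, h, rfl, rfl⟩

@[simp] theorem forbidden_inr_inl {i i' : Fin m} {j j' : Fin n} :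
    LForbidden (Sum.inr (j, i)) (Sum.inl (i', j')) ↔ (i : ℕ) = m - 1 ∧ i' = i := by
  constructor
  · rintro (⟨_, _, _, _, e, _⟩ | ⟨_, _, _, h, e, e'⟩) <;> simp_all
  · rintro ⟨h, rfl⟩
    exact Or.inr ⟨j, j', _, h, rfl, rfl⟩

@[simp] theorem not_forbidden_inl_inl {p q : Fin m × Fin n} :
    ¬ LForbidden (Sum.inl p) (Sum.inl q) := by
  rintro (⟨_, _, _, _, _, e⟩ | ⟨_, _, _, _, e, _⟩) <;> simp at e

@[simp] theorem not_forbidden_inr_inr {p q : Fin n × Fin m} :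
    ¬ LForbidden (Sum.inr p) (Sum.inr q) := by
  rintro (⟨_, _, _, _, e, _⟩ | ⟨_, _, _, _, _, e⟩) <;> simp at e

/-- Whether an `x`-letter may be put in front of a word depends only on its second index. -/
theorem irr_inl_cons_congr (i i' : Fin m) (j : Fin n) (w : LWord m n) :
    LWord.Irr (Sum.inl (i, j) :: w) ↔ LWord.Irr (Sum.inl (i', j) :: w) := by
  rcases w with _ | ⟨_ | ⟨_, _⟩, w⟩ <;> simp [irr_singleton, irr_cons_cons]

/-- Whether a `y`-letter may be put in front of a word depends only on its second index. -/
theorem irr_inr_cons_congr (j j' : Fin n) (i : Fin m) (w : LWord m n) :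
    LWord.Irr (Sum.inr (j, i) :: w) ↔ LWord.Irr (Sum.inr (j', i) :: w) := by
  rcases w with _ | ⟨⟨_, _⟩ | _, w⟩ <;> simp [irr_singleton, irr_cons_cons]

variable (K) in
/-- The result of putting a letter in front of a word and reducing the forbidden pair of letters
that may arise at the front. -/
noncomputable def reduceCons : LGen m n → LWord m n → (LWord m n →₀ K)
  | Sum.inl (i, j), Sum.inr (j', i') :: v =>
    if (j : ℕ) = n - 1 ∧ j' = j then
      (if i = i' then Finsupp.single v 1 else 0) -
        ∑ k ∈ Finset.univ.erase j, Finsupp.single (Sum.inl (i, k) :: Sum.inr (k, i') :: v) 1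
    else Finsupp.single (Sum.inl (i, j) :: Sum.inr (j', i') :: v) 1
  | Sum.inr (j, i), Sum.inl (i', j') :: v =>
    if (i : ℕ) = m - 1 ∧ i' = i then
      (if j = j' then Finsupp.single v 1 else 0) -
        ∑ k ∈ Finset.univ.erase i, Finsupp.single (Sum.inr (j, k) :: Sum.inl (k, j') :: v) 1
    else Finsupp.single (Sum.inr (j, i) :: Sum.inl (i', j') :: v) 1
  | z, w => Finsupp.single (z :: w) 1

theorem reduceCons_of_irr {z : LGen m n} {w : LWord m n} (h : LWord.Irr (z :: w)) :
    reduceCons K z w = Finsupp.single (z :: w) 1 := by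
  rcases z with ⟨_, _⟩ | ⟨_, _⟩ <;> rcases w with _ | ⟨⟨_, _⟩ | ⟨_, _⟩, w⟩ <;>
    simp_all [irr_cons_cons, reduceCons]

theorem reduceCons_mem_supported (z : LGen m n) {w : LWord m n} (h : w.Irr) :
    reduceCons K z w ∈ Finsupp.supported K K {w : LWord m n | w.Irr} := by
  by_cases hz : LWord.Irr (z :: w)
  · rw [reduceCons_of_irr hz]
    exact Finsupp.single_mem_supported K 1 hz
  rcases z with ⟨i, j⟩ | ⟨j, i⟩ <;> rcases w with _ | ⟨⟨i', j'⟩ | ⟨j', i'⟩, v⟩ <;>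
    simp [irr_cons_cons, irr_singleton, h] at hz
  · obtain ⟨hj, rfl⟩ := hz
    simp only [reduceCons, hj, true_and, if_true]
    refine sub_mem ?_ (Submodule.sum_mem _ fun k hk => Finsupp.single_mem_supported K 1 ?_)
    · split_ifs
      exacts [Finsupp.single_mem_supported K 1 (irr_tail h), zero_mem _]
    · refine irr_cons_cons.2 ⟨?_, (irr_inr_cons_congr _ _ _ _).1 h⟩
      simp only [forbidden_inl_inr, and_true]
      intro hk'
      exact (Finset.mem_erase.1 hk).1 (Fin.ext (hk'.trans hj.symm))
  · obtain ⟨hi, rfl⟩ := hz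
    simp only [reduceCons, hi, true_and, if_true]
    refine sub_mem ?_ (Submodule.sum_mem _ fun k hk => Finsupp.single_mem_supported K 1 ?_)
    · split_ifs
      exacts [Finsupp.single_mem_supported K 1 (irr_tail h), zero_mem _]
    · refine irr_cons_cons.2 ⟨?_, (irr_inl_cons_congr _ _ _ _).1 h⟩
      simp only [forbidden_inr_inl, and_true]
      intro hk'
      exact (Finset.mem_erase.1 hk).1 (Fin.ext (hk'.trans hi.symm))

theorem sum_xg_mul_yg (i i' : Fin m) :
    ∑ j : Fin n, lgen K (Sum.inl (i, j)) * lgen K (Sum.inr (j, i')) =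
      if i = i' then (1 : Leavitt K m n) else 0 := by
  have h := RingQuot.mkAlgHom_rel K (LRel.xy (K := K) (n := n) i i')
  rw [map_sum, apply_ite (RingQuot.mkAlgHom K (LRel K m n))] at h
  simpa only [map_mul, map_one, map_zero, lgen] using h

theorem sum_yg_mul_xg (j j' : Fin n) :
    ∑ i : Fin m, lgen K (Sum.inr (j, i)) * lgen K (Sum.inl (i, j')) =
      if j = j' then (1 : Leavitt K m n) else 0 := by
  have h := RingQuot.mkAlgHom_rel K (LRel.yx (K := K) (m := m) j j')
  rw [map_sum, apply_ite (RingQuot.mkAlgHom K (LRel K m n))] at h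
  simpa only [map_mul, map_one, map_zero, lgen] using h

@[simp] theorem wordToL_cons (z : LGen m n) (w : LWord m n) :
    wordToL K (z :: w) = lgen K z * wordToL K w := by
  simp [wordToL]

theorem linearCombination_reduceCons (z : LGen m n) (w : LWord m n) :
    Finsupp.linearCombination K (wordToL K) (reduceCons K z w) = lgen K z * wordToL K w := by
  rcases z with ⟨i, j⟩ | ⟨j, i⟩ <;> rcases w with _ | ⟨⟨i', j'⟩ | ⟨j', i'⟩, v⟩ <;>
    simp only [reduceCons]
  any_goals (simp; done)
  · by_cases h : (j : ℕ) = n - 1 ∧ j' = j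
    · rw [if_pos h]
      obtain ⟨-, rfl⟩ := h
      have := sum_xg_mul_yg (K := K) (n := n) i i'
      rw [← Finset.add_sum_erase _ _ (Finset.mem_univ j'), ← eq_sub_iff_add_eq] at this
      simp only [map_sub, map_sum, Finsupp.linearCombination_single, one_smul, wordToL_cons,
        ← mul_assoc, ← Finset.sum_mul, this, sub_mul]
      split_ifs <;> simp
    · rw [if_neg h]
      simp
  · by_cases h : (i : ℕ) = m - 1 ∧ i' = i
    · rw [if_pos h]
      obtain ⟨-, rfl⟩ := h
      have := sum_yg_mul_xg (K := K) (m := m) j j'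
      rw [← Finset.add_sum_erase _ _ (Finset.mem_univ i'), ← eq_sub_iff_add_eq] at this
      simp only [map_sub, map_sum, Finsupp.linearCombination_single, one_smul, wordToL_cons,
        ← mul_assoc, ← Finset.sum_mul, this, sub_mul]
      split_ifs <;> simp
    · rw [if_neg h]
      simp

variable (K) in
/-- The linear extension of `reduceCons` to the space spanned by all words. -/
noncomputable def letterMap (z : LGen m n) : (LWord m n →₀ K) →ₗ[K] (LWord m n →₀ K) :=
  Finsupp.linearCombination K (reduceCons K z)

@[simp] theorem letterMap_single (z : LGen m n) (w : LWord m n) :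
    letterMap K z (Finsupp.single w 1) = reduceCons K z w := by
  simp [letterMap]

theorem sum_letterMap_inl_inr_single (hn : 0 < n) (i i' : Fin m) (v : LWord m n) :
    ∑ j : Fin n, letterMap K (Sum.inl (i, j)) (Finsupp.single (Sum.inr (j, i') :: v) 1) =
      if i = i' then Finsupp.single v 1 else 0 := by
  rw [← Finset.add_sum_erase _ _ (Finset.mem_univ (⟨n - 1, by omega⟩ : Fin n))]
  have : ∀ k ∈ Finset.univ.erase (⟨n - 1, by omega⟩ : Fin n),
      letterMap K (Sum.inl (i, k)) (Finsupp.single (Sum.inr (k, i') :: v) 1) =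
        Finsupp.single (Sum.inl (i, k) :: Sum.inr (k, i') :: v) 1 := by
    intro k hk
    have hk' : (k : ℕ) ≠ n - 1 := fun h => (Finset.mem_erase.1 hk).1 (Fin.ext h)
    simp [reduceCons, hk']
  rw [Finset.sum_congr rfl this]
  simp [reduceCons]

theorem sum_letterMap_inr_inl_single (hm : 0 < m) (j j' : Fin n) (v : LWord m n) :
    ∑ i : Fin m, letterMap K (Sum.inr (j, i)) (Finsupp.single (Sum.inl (i, j') :: v) 1) =
      if j = j' then Finsupp.single v 1 else 0 := by
  rw [← Finset.add_sum_erase _ _ (Finset.mem_univ (⟨m - 1, by omega⟩ : Fin m))]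
  have : ∀ k ∈ Finset.univ.erase (⟨m - 1, by omega⟩ : Fin m),
      letterMap K (Sum.inr (j, k)) (Finsupp.single (Sum.inl (k, j') :: v) 1) =
        Finsupp.single (Sum.inr (j, k) :: Sum.inl (k, j') :: v) 1 := by
    intro k hk
    have hk' : (k : ℕ) ≠ m - 1 := fun h => (Finset.mem_erase.1 hk).1 (Fin.ext h)
    simp [reduceCons, hk']
  rw [Finset.sum_congr rfl this]
  simp [reduceCons]

theorem sum_letterMap_inl_inr (hn : 0 < n) (i i' : Fin m) {w : LWord m n} (hw : w.Irr) :
    ∑ j : Fin n, letterMap K (Sum.inl (i, j)) (reduceCons K (Sum.inr (j, i')) w) =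
      if i = i' then Finsupp.single w 1 else 0 := by
  by_cases h : LWord.Irr (Sum.inr ((⟨0, hn⟩ : Fin n), i') :: w)
  · rw [← sum_letterMap_inl_inr_single hn i i' w]
    exact Finset.sum_congr rfl fun j _ => by
      rw [reduceCons_of_irr ((irr_inr_cons_congr _ _ _ _).1 h)]
  rcases w with _ | ⟨⟨l, k⟩ | ⟨k, l⟩, v⟩ <;> simp [irr_cons_cons, irr_singleton, hw] at h
  obtain ⟨hl, rfl⟩ := h
  simp only [reduceCons, hl, true_and, if_true, map_sub, map_sum, Finset.sum_sub_distrib]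
  rw [Finset.sum_comm]
  simp only [sum_letterMap_inl_inr_single hn]
  simp only [apply_ite (letterMap K _), map_zero,
    Finset.sum_ite_eq', Finset.mem_univ, if_true, letterMap_single]
  rw [reduceCons_of_irr ((irr_inl_cons_congr _ _ _ _).1 hw)]
  by_cases hi : i = l <;> simp [hi]

theorem sum_letterMap_inr_inl (hm : 0 < m) (j j' : Fin n) {w : LWord m n} (hw : w.Irr) :
    ∑ i : Fin m, letterMap K (Sum.inr (j, i)) (reduceCons K (Sum.inl (i, j')) w) =
      if j = j' then Finsupp.single w 1 else 0 := by
  by_cases h : LWord.Irr (Sum.inl ((⟨0, hm⟩ : Fin m), j') :: w)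
  · rw [← sum_letterMap_inr_inl_single hm j j' w]
    exact Finset.sum_congr rfl fun i _ => by
      rw [reduceCons_of_irr ((irr_inl_cons_congr _ _ _ _).1 h)]
  rcases w with _ | ⟨⟨l, k⟩ | ⟨k, l⟩, v⟩ <;> simp [irr_cons_cons, irr_singleton, hw] at h
  obtain ⟨hk, rfl⟩ := h
  simp only [reduceCons, hk, true_and, if_true, map_sub, map_sum, Finset.sum_sub_distrib]
  rw [Finset.sum_comm]
  simp only [sum_letterMap_inr_inl_single hm]
  simp only [apply_ite (letterMap K _), map_zero,
    Finset.sum_ite_eq', Finset.mem_univ, if_true, letterMap_single]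
  rw [reduceCons_of_irr ((irr_inr_cons_congr _ _ _ _).1 hw)]
  by_cases hj : j = k <;> simp [hj]

variable (K m n) in
/-- The space with basis the irreducible words. -/
noncomputable abbrev irrSpace : Submodule K (LWord m n →₀ K) :=
  Finsupp.supported K K {w : LWord m n | w.Irr}

theorem irrSpace_induction {p : (f : LWord m n →₀ K) → f ∈ irrSpace K m n → Prop}
    (single : ∀ (w : LWord m n) (hw : w.Irr),
      p (Finsupp.single w 1) (Finsupp.single_mem_supported K 1 hw))
    (zero : p 0 (zero_mem _))
    (add : ∀ f g hf hg, p f hf → p g hg → p (f + g) (add_mem hf hg))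
    (smul : ∀ (c : K) f hf, p f hf → p (c • f) (Submodule.smul_mem _ c hf))
    {f : LWord m n →₀ K} (hf : f ∈ irrSpace K m n) : p f hf := by
  have hs : irrSpace K m n = _ := Finsupp.supported_eq_span_single K {w : LWord m n | w.Irr}
  have hf' := hf
  rw [hs] at hf'
  induction hf' using Submodule.span_induction with
  | mem x hx => obtain ⟨w, hw, rfl⟩ := hx; exact single w hw
  | zero => exact zero
  | add f g hf₁ hg₁ ihf ihg => exact add f g _ _ (ihf (hs.symm ▸ hf₁)) (ihg (hs.symm ▸ hg₁))
  | smul c f hf₁ ih => exact smul c f _ (ih (hs.symm ▸ hf₁))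

theorem letterMap_mem (z : LGen m n) {f : LWord m n →₀ K} (hf : f ∈ irrSpace K m n) :
    letterMap K z f ∈ irrSpace K m n := by
  induction hf using irrSpace_induction with
  | single w hw => rw [letterMap_single]; exact reduceCons_mem_supported z hw
  | zero => rw [map_zero]; exact zero_mem _
  | add f g _ _ hf hg => rw [map_add]; exact add_mem hf hg
  | smul c f _ hf => rw [map_smul]; exact Submodule.smul_mem _ c hf

variable (K) in
/-- The action of a letter on the space of irreducible words. -/
noncomputable def letterEnd (z : LGen m n) : Module.End K (irrSpace K m n) :=
  (letterMap K z).restrict fun _ => letterMap_mem z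

/-- Endomorphisms of `irrSpace` agree if they agree on irreducible words. -/
theorem end_ext {f g : Module.End K (irrSpace K m n)}
    (h : ∀ (w : LWord m n) (hw : w.Irr),
      f ⟨Finsupp.single w 1, Finsupp.single_mem_supported K 1 hw⟩ =
        g ⟨Finsupp.single w 1, Finsupp.single_mem_supported K 1 hw⟩) : f = g := by
  refine LinearMap.ext fun ⟨a, ha⟩ => ?_
  induction ha using irrSpace_induction with
  | single w hw => exact h w hw
  | zero => exact (map_zero f).trans (map_zero g).symm
  | add a b ha hb ea eb =>
    have : f (⟨a, ha⟩ + ⟨b, hb⟩) = g (⟨a, ha⟩ + ⟨b, hb⟩) := by rw [map_add, map_add, ea, eb]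
    exact this
  | smul c a ha ea =>
    have : f (c • ⟨a, ha⟩) = g (c • ⟨a, ha⟩) := by rw [map_smul, map_smul, ea]
    exact this

theorem lift_letterEnd_rel (hm : 0 < m) (hn : 0 < n) ⦃a b : FreeAlgebra K (LGen m n)⦄
    (h : LRel K m n a b) :
    FreeAlgebra.lift K (letterEnd K) a = FreeAlgebra.lift K (letterEnd K) b := by
  rcases h with ⟨i, i'⟩ | ⟨j, j'⟩
  · refine end_ext fun w hw => Subtype.ext ?_
    have := sum_letterMap_inl_inr (K := K) hn i i' hw
    split_ifs at this ⊢ <;> simpa [letterEnd] using this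
  · refine end_ext fun w hw => Subtype.ext ?_
    have := sum_letterMap_inr_inl (K := K) hm j j' hw
    split_ifs at this ⊢ <;> simpa [letterEnd] using this

/-- The representation of the Leavitt algebra on the space of irreducible words. -/
noncomputable def irrRep (hm : 0 < m) (hn : 0 < n) :
    Leavitt K m n →ₐ[K] Module.End K (irrSpace K m n) :=
  RingQuot.liftAlgHom K ⟨FreeAlgebra.lift K (letterEnd K), lift_letterEnd_rel hm hn⟩

theorem irrRep_lgen (hm : 0 < m) (hn : 0 < n) (z : LGen m n) :
    irrRep hm hn (lgen K z) = letterEnd K z := by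
  simp [irrRep, lgen]

theorem irrRep_wordToL (hm : 0 < m) (hn : 0 < n) {w : LWord m n} (hw : w.Irr) :
    (irrRep hm hn (wordToL K w)
      ⟨Finsupp.single [] 1, Finsupp.single_mem_supported K 1 irr_nil⟩ : LWord m n →₀ K) =
        Finsupp.single w 1 := by
  induction w with
  | nil => simp [wordToL]
  | cons z w ih =>
    rw [wordToL_cons, map_mul, irrRep_lgen, Module.End.mul_apply, letterEnd,
      LinearMap.coe_restrict_apply, ih (irr_tail hw), letterMap_single,
      reduceCons_of_irr hw]

theorem linearIndependent_wordToL (hm : 0 < m) (hn : 0 < n) :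
    LinearIndependent K (fun w : {w : LWord m n // w.Irr} => wordToL K w.1) := by
  let e : Leavitt K m n →ₗ[K] (LWord m n →₀ K) :=
    (irrSpace K m n).subtype ∘ₗ
      LinearMap.applyₗ ⟨Finsupp.single [] 1, Finsupp.single_mem_supported K 1 irr_nil⟩ ∘ₗ
        (irrRep hm hn).toLinearMap
  refine LinearIndependent.of_comp e ?_
  have he : e ∘ (fun w : {w : LWord m n // w.Irr} => wordToL K w.1) =
      (fun w : LWord m n => Finsupp.single w (1 : K)) ∘ Subtype.val :=
    funext fun w => irrRep_wordToL hm hn w.2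
  rw [he]
  exact (Finsupp.linearIndependent_single_one K _).comp _ Subtype.val_injective

variable (K m n) in
/-- The span of the images of the irreducible words. -/
noncomputable abbrev irrSpan : Submodule K (Leavitt K m n) :=
  Submodule.span K (Set.range fun w : {w : LWord m n // w.Irr} => wordToL K w.1)

theorem lgen_mul_mem_irrSpan (z : LGen m n) {s : Leavitt K m n} (hs : s ∈ irrSpan K m n) :
    lgen K z * s ∈ irrSpan K m n := by
  induction hs using Submodule.span_induction with
  | mem x hx =>
    obtain ⟨⟨w, hw⟩, rfl⟩ := hx
    rw [← linearCombination_reduceCons]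
    have := (Finsupp.mem_span_image_iff_linearCombination K (v := wordToL K)).2
      ⟨_, reduceCons_mem_supported z hw, rfl⟩
    rwa [Set.image_eq_range] at this
  | zero => rw [mul_zero]; exact zero_mem _
  | add a b _ _ ha hb => rw [mul_add]; exact add_mem ha hb
  | smul c a _ ha => rw [mul_smul_comm]; exact Submodule.smul_mem _ c ha

theorem mk_mul_mem_irrSpan (a : FreeAlgebra K (LGen m n)) :
    ∀ s ∈ irrSpan K m n, RingQuot.mkAlgHom K (LRel K m n) a * s ∈ irrSpan K m n := by
  induction a using FreeAlgebra.induction with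
  | grade0 r =>
    intro s hs
    rw [AlgHom.commutes, ← Algebra.smul_def]
    exact Submodule.smul_mem _ r hs
  | grade1 z => exact fun s hs => lgen_mul_mem_irrSpan z hs
  | mul a b ha hb =>
    intro s hs
    rw [map_mul, mul_assoc]
    exact ha _ (hb s hs)
  | add a b ha hb =>
    intro s hs
    rw [map_add, add_mul]
    exact add_mem (ha s hs) (hb s hs)

theorem irrSpan_eq_top : irrSpan K m n = ⊤ := by
  refine eq_top_iff.2 fun a _ => ?_
  obtain ⟨b, rfl⟩ := RingQuot.mkAlgHom_surjective K (LRel K m n) a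
  have one_mem : (1 : Leavitt K m n) ∈ irrSpan K m n :=
    Submodule.subset_span ⟨⟨[], irr_nil⟩, by simp [wordToL]⟩
  simpa using mk_mul_mem_irrSpan b 1 one_mem

end Leavitt

/-- The images in `L(m,n)` of the irreducible words form a `K`-linear
basis of `L(m,n)`. -/
theorem stmt2 (K : Type) [Field K] (m n : ℕ) (hm : 0 < m) (hn : 0 < n) :
    LinearIndependent K (fun w : {w : LWord m n // w.Irr} => wordToL K w.1) ∧
    Submodule.span K (Set.range fun w : {w : LWord m n // w.Irr} => wordToL K w.1) = ⊤ :=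
  ⟨Leavitt.linearIndependent_wordToL hm hn, Leavitt.irrSpan_eq_top⟩
end

section
/- The subspace K⟨X⟩_0^{xy} of the free algebra K⟨X⟩ is closed under the reductions of the system S: if w ∈ ⟨X⟩_0^{xy} is written as w = u·w_σ·v for words u, v and a forbidden word w_σ equal to x_{in} y_{ni'} (with replacement f_σ = δ_{i,i'} − Σ_{j=1}^{n−1} x_{ij} y_{ji'}) or equal to y_{jm} x_{mj'} (with replacement f_σ = δ_{j,j'} − Σ_{i=1}^{m−1} y_{ji} x_{ij'}), then the element u·f_σ·v of K⟨X⟩ is a K-linear combination of words in ⟨X⟩_0^{xy}. The analogous statement holds for K⟨X⟩_0^{yx}. -/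
open scoped BigOperators

/-- The image of a word in the free algebra `K⟨X⟩`. -/
noncomputable def wordToF (K : Type) [Field K] {m n : ℕ} (w : LWord m n) :
    FreeAlgebra K (LGen m n) :=
  (w.map (FreeAlgebra.ι K)).prod

/-- The subspace `K⟨X⟩₀^{xy}` of `K⟨X⟩` : the `K`-linear span of the words
in the submonoid `⟨X⟩₀^{xy}`. -/
noncomputable def spanXYF (K : Type) [Field K] (m n : ℕ) :
    Submodule K (FreeAlgebra K (LGen m n)) :=
  Submodule.span K {a | ∃ w : LWord m n, w.InXY ∧ wordToF K w = a}

/-- The subspace `K⟨X⟩₀^{yx}` of `K⟨X⟩`. -/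
noncomputable def spanYXF (K : Type) [Field K] (m n : ℕ) :
    Submodule K (FreeAlgebra K (LGen m n)) :=
  Submodule.span K {a | ∃ w : LWord m n, w.InYX ∧ wordToF K w = a}

/-- The replacement `f_σ = δ_{i,i'} − ∑_{j=1}^{n−1} x_{ij} y_{ji'}` for the forbidden word
`x_{in} y_{ni'}`. -/
noncomputable def fRedX (K : Type) [Field K] {m n : ℕ} (i i' : Fin m) :
    FreeAlgebra K (LGen m n) :=
  (if i = i' then 1 else 0) -
    ∑ j ∈ Finset.univ.filter (fun j : Fin n => (j : ℕ) < n - 1),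
      FreeAlgebra.ι K (Sum.inl (i, j)) * FreeAlgebra.ι K (Sum.inr (j, i'))

/-- The replacement `f_σ = δ_{j,j'} − ∑_{i=1}^{m−1} y_{ji} x_{ij'}` for the forbidden word
`y_{jm} x_{mj'}`. -/
noncomputable def fRedY (K : Type) [Field K] {m n : ℕ} (j j' : Fin n) :
    FreeAlgebra K (LGen m n) :=
  (if j = j' then 1 else 0) -
    ∑ i ∈ Finset.univ.filter (fun i : Fin m => (i : ℕ) < m - 1),
      FreeAlgebra.ι K (Sum.inr (j, i)) * FreeAlgebra.ι K (Sum.inl (i, j'))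

namespace LWord

variable {m n : ℕ}

theorem degree_nil : degree ([] : LWord m n) = 0 := by
  simp [degree]

theorem degree_append (u v : LWord m n) : degree (u ++ v) = degree u + degree v := by
  simp only [degree, List.countP_append]
  push_cast
  ring

theorem degree_singleton_inl (p : Fin m × Fin n) :
    degree ([Sum.inl p] : LWord m n) = 1 := by
  simp [degree]

theorem degree_singleton_inr (q : Fin n × Fin m) :
    degree ([Sum.inr q] : LWord m n) = -1 := by
  simp [degree]

theorem degree_cons (a : LGen m n) (w : LWord m n) :
    degree (a :: w) = degree [a] + degree w :=
  degree_append [a] w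

theorem degree_singleton_eq (a : LGen m n) : degree [a] = 1 ∨ degree [a] = -1 := by
  rcases a with p | q
  · exact Or.inl (degree_singleton_inl p)
  · exact Or.inr (degree_singleton_inr q)

theorem balanced_iff_degree (w : LWord m n) : w.Balanced ↔ w.degree = 0 := by
  unfold Balanced degree
  omega

/-- All heights along the lattice path of `w`, started at height `h` and with steps scaled
by `ε`, are nonnegative. -/
def PathNonneg (ε h : ℤ) (w : LWord m n) : Prop :=
  ∀ p : LWord m n, p <+: w → 0 ≤ h + ε * degree p

/-- Dyck words: balanced words all of whose prefixes have degree of the sign of `ε`. -/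
def Dyck (ε : ℤ) (w : LWord m n) : Prop :=
  degree w = 0 ∧ PathNonneg ε 0 w

theorem pathNonneg_nil {ε h : ℤ} : PathNonneg ε h ([] : LWord m n) ↔ 0 ≤ h := by
  simp [PathNonneg, degree_nil]

theorem pathNonneg_cons {ε h : ℤ} {a : LGen m n} {w : LWord m n} :
    PathNonneg ε h (a :: w) ↔ 0 ≤ h ∧ PathNonneg ε (h + ε * degree [a]) w := by
  constructor
  · intro H
    refine ⟨by simpa [degree_nil] using H [] List.nil_prefix, fun p hp => ?_⟩
    have := H (a :: p) (List.cons_prefix_cons.2 ⟨rfl, hp⟩)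
    rw [degree_cons] at this
    linarith
  · rintro ⟨h0, H⟩ p hp
    rcases List.prefix_cons_iff.1 hp with rfl | ⟨t, rfl, ht⟩
    · simpa [degree_nil] using h0
    · have := H t ht
      rw [degree_cons]
      linarith

theorem pathNonneg_append {ε h : ℤ} {u v : LWord m n} :
    PathNonneg ε h (u ++ v) ↔ PathNonneg ε h u ∧ PathNonneg ε (h + ε * degree u) v := by
  induction u generalizing h with
  | nil =>
    simp only [List.nil_append, pathNonneg_nil, degree_nil, mul_zero, add_zero]
    exact ⟨fun H => ⟨by simpa [degree_nil] using H [] List.nil_prefix, H⟩, And.right⟩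
  | cons a u ih =>
    rw [List.cons_append, pathNonneg_cons, pathNonneg_cons, ih, degree_cons a u, and_assoc,
      mul_add, add_assoc]

theorem dyck_nil (ε : ℤ) : Dyck ε ([] : LWord m n) :=
  ⟨degree_nil, pathNonneg_nil.2 le_rfl⟩

theorem dyck_append_iff {ε : ℤ} {u v : LWord m n} (hu : degree u = 0) :
    Dyck ε (u ++ v) ↔ Dyck ε u ∧ Dyck ε v := by
  simp only [Dyck, pathNonneg_append, degree_append, hu, mul_zero, add_zero, zero_add]
  tauto

theorem dyck_flatten {ε : ℤ} {ws : List (LWord m n)} (h : ∀ u ∈ ws, Dyck ε u) :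
    Dyck ε (ws.flatten : LWord m n) := by
  induction ws with
  | nil => exact dyck_nil ε
  | cons u ws ih =>
    rw [List.flatten_cons, dyck_append_iff (h u List.mem_cons_self).1]
    exact ⟨h u List.mem_cons_self, ih fun x hx => h x (List.mem_cons_of_mem _ hx)⟩

/-- Deleting a balanced pair of adjacent letters preserves Dyck words. -/
theorem Dyck.remove_pair {ε : ℤ} {u v : LWord m n} {a b : LGen m n}
    (hab : degree [a] + degree [b] = 0) (h : Dyck ε (u ++ a :: b :: v)) : Dyck ε (u ++ v) := by
  obtain ⟨hd, hp⟩ := h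
  refine ⟨?_, ?_⟩
  · rw [degree_append, degree_cons a, degree_cons b] at hd
    rw [degree_append]
    linarith
  · rw [pathNonneg_append, pathNonneg_cons, pathNonneg_cons, add_assoc (_ + _), ← mul_add, hab,
      mul_zero, add_zero] at hp
    exact pathNonneg_append.2 ⟨hp.1, hp.2.2.2⟩

/-- Replacing letters by letters of the same kind preserves Dyck words. -/
theorem Dyck.replace_pair {ε : ℤ} {u v : LWord m n} {a b a' b' : LGen m n}
    (ha : degree [a'] = degree [a]) (hb : degree [b'] = degree [b])
    (h : Dyck ε (u ++ a :: b :: v)) : Dyck ε (u ++ a' :: b' :: v) := by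
  obtain ⟨hd, hp⟩ := h
  refine ⟨?_, ?_⟩
  · rw [degree_append, degree_cons a, degree_cons b] at hd
    rwa [degree_append, degree_cons a', degree_cons b', ha, hb]
  · rw [pathNonneg_append, pathNonneg_cons, pathNonneg_cons] at hp ⊢
    rwa [ha, hb]

/-- A prime word stays on the side of zero given by its first letter. -/
theorem IsPrime.dyck {ε : ℤ} (hε : ε = 1 ∨ ε = -1) {a : LGen m n} {t : LWord m n}
    (hw : IsPrime (a :: t)) (ha : degree [a] = ε) : Dyck ε (a :: t) := by
  refine ⟨(balanced_iff_degree _).1 hw.2.1, fun p => ?_⟩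
  induction p using List.reverseRecOn with
  | nil => simp [degree_nil]
  | append_singleton p z ih =>
    intro hp
    have hprev := ih ((List.prefix_append p [z]).trans hp)
    by_cases hnil : p = []
    · subst hnil
      obtain rfl : z = a := (List.cons_prefix_cons.1 hp).1
      rw [List.nil_append, ha]
      rcases hε with rfl | rfl <;> norm_num
    · obtain ⟨q, hq⟩ := hp
      have hne : degree p ≠ 0 := fun h0 =>
        hw.2.2 p (z :: q) (by simpa using hq.symm) hnil (List.cons_ne_nil _ _)
          ((balanced_iff_degree p).2 h0)
      rw [degree_append]
      rcases hε with rfl | rfl <;> rcases degree_singleton_eq z with hz | hz <;> omega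

/-- The first letter of a nonempty Dyck word has degree `ε` and the last letter `-ε`. -/
theorem Dyck.head_getLast {ε : ℤ} (hε : ε = 1 ∨ ε = -1) {w : LWord m n} (hw : Dyck ε w)
    (hne : w ≠ []) :
    (∃ a, w.head? = some a ∧ degree [a] = ε) ∧ ∃ b, w.getLast? = some b ∧ degree [b] = -ε := by
  constructor
  · obtain ⟨a, t, rfl⟩ := List.exists_cons_of_ne_nil hne
    refine ⟨a, rfl, ?_⟩
    have := hw.2 [a] (List.cons_prefix_cons.2 ⟨rfl, List.nil_prefix⟩)
    rcases hε with rfl | rfl <;> rcases degree_singleton_eq a with h | h <;> omega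
  · obtain ⟨t, b, rfl⟩ := List.eq_nil_or_concat w |>.resolve_left hne
    rw [List.concat_eq_append] at hw ⊢
    refine ⟨b, by simp, ?_⟩
    have h1 := hw.2 t (List.prefix_append t [b])
    have h2 := hw.1
    rw [degree_append] at h2
    rcases hε with rfl | rfl <;> rcases degree_singleton_eq b with h | h <;> omega

/-- Every Dyck word is a concatenation of prime Dyck words. -/
theorem Dyck.exists_prime_factorization {ε : ℤ} {w : LWord m n} (hw : Dyck ε w) :
    ∃ ws : List (LWord m n), (∀ u ∈ ws, u.IsPrime ∧ Dyck ε u) ∧ ws.flatten = w := by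
  induction hk : w.length using Nat.strong_induction_on generalizing w with
  | _ k ih =>
    subst hk
    by_cases hne : w = []
    · exact ⟨[], by simp, by simp [hne]⟩
    by_cases hprime : w.IsPrime
    · exact ⟨[w], by simp [hprime, hw], by simp⟩
    have hbal := (balanced_iff_degree w).2 hw.1
    obtain ⟨u, v, rfl, hu, hv, hub⟩ :
        ∃ u v : LWord m n, w = u ++ v ∧ u ≠ [] ∧ v ≠ [] ∧ u.Balanced := by
      by_contra hcon
      exact hprime ⟨hne, hbal, fun u v h hu hv hb => hcon ⟨u, v, h, hu, hv, hb⟩⟩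
    obtain ⟨hdu, hdv⟩ := (dyck_append_iff ((balanced_iff_degree u).1 hub)).1 hw
    have hlu := List.length_pos_iff.2 hu
    have hlv := List.length_pos_iff.2 hv
    obtain ⟨us, hus, rfl⟩ := ih u.length (by rw [List.length_append]; omega) hdu rfl
    obtain ⟨vs, hvs, rfl⟩ := ih v.length (by rw [List.length_append]; omega) hdv rfl
    refine ⟨us ++ vs, fun x hx => ?_, List.flatten_append⟩
    exact (List.mem_append.1 hx).elim (hus x) (hvs x)

theorem IsPrime.xy_iff_dyck {w : LWord m n} (hw : w.IsPrime) : w.XY ↔ Dyck 1 w := by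
  constructor
  · rintro ⟨-, ⟨p, hp⟩, -⟩
    obtain ⟨t, rfl⟩ := List.head?_eq_some_iff.1 hp
    exact hw.dyck (Or.inl rfl) (degree_singleton_inl p)
  · intro h
    obtain ⟨⟨a, ha, hda⟩, b, hb, hdb⟩ := h.head_getLast (Or.inl rfl) hw.1
    refine ⟨hw.2.1, ?_, ?_⟩
    · rcases a with p | q
      · exact ⟨p, ha⟩
      · rw [degree_singleton_inr] at hda
        omega
    · rcases b with p | q
      · rw [degree_singleton_inl] at hdb
        omega
      · exact ⟨q, hb⟩

theorem IsPrime.yx_iff_dyck {w : LWord m n} (hw : w.IsPrime) : w.YX ↔ Dyck (-1) w := by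
  constructor
  · rintro ⟨-, ⟨q, hq⟩, -⟩
    obtain ⟨t, rfl⟩ := List.head?_eq_some_iff.1 hq
    exact hw.dyck (Or.inr rfl) (degree_singleton_inr q)
  · intro h
    obtain ⟨⟨a, ha, hda⟩, b, hb, hdb⟩ := h.head_getLast (Or.inr rfl) hw.1
    refine ⟨hw.2.1, ?_, ?_⟩
    · rcases a with p | q
      · rw [degree_singleton_inl] at hda
        omega
      · exact ⟨q, ha⟩
    · rcases b with p | q
      · exact ⟨p, hb⟩
      · rw [degree_singleton_inr] at hdb
        omega

theorem inXY_iff_dyck (w : LWord m n) : w.InXY ↔ Dyck 1 w := by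
  constructor
  · rintro ⟨ws, hws, rfl⟩
    exact dyck_flatten fun u hu => (hws u hu).1.xy_iff_dyck.1 (hws u hu).2
  · intro h
    obtain ⟨ws, hws, rfl⟩ := h.exists_prime_factorization
    exact ⟨ws, fun u hu => ⟨(hws u hu).1, (hws u hu).1.xy_iff_dyck.2 (hws u hu).2⟩, rfl⟩

theorem inYX_iff_dyck (w : LWord m n) : w.InYX ↔ Dyck (-1) w := by
  constructor
  · rintro ⟨ws, hws, rfl⟩
    exact dyck_flatten fun u hu => (hws u hu).1.yx_iff_dyck.1 (hws u hu).2
  · intro h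
    obtain ⟨ws, hws, rfl⟩ := h.exists_prime_factorization
    exact ⟨ws, fun u hu => ⟨(hws u hu).1, (hws u hu).1.yx_iff_dyck.2 (hws u hu).2⟩, rfl⟩

end LWord

/-- The span of the Dyck words in the free algebra. -/
noncomputable def spanDyck (K : Type) [Field K] (m n : ℕ) (ε : ℤ) :
    Submodule K (FreeAlgebra K (LGen m n)) :=
  Submodule.span K {a | ∃ w : LWord m n, LWord.Dyck ε w ∧ wordToF K w = a}

theorem spanXYF_eq_spanDyck (K : Type) [Field K] (m n : ℕ) :
    spanXYF K m n = spanDyck K m n 1 := by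
  simp only [spanXYF, spanDyck, LWord.inXY_iff_dyck]

theorem spanYXF_eq_spanDyck (K : Type) [Field K] (m n : ℕ) :
    spanYXF K m n = spanDyck K m n (-1) := by
  simp only [spanYXF, spanDyck, LWord.inYX_iff_dyck]

/-- Replacing a balanced pair of adjacent letters in a Dyck word by a scalar `δ ∈ {0, 1}` minus
a sum of pairs of letters of the same kinds stays in the span of the Dyck words. -/
theorem reduction_mem_spanDyck (K : Type) [Field K] {m n : ℕ} {ε : ℤ} {ι : Type*}
    {u v : LWord m n} {a b : LGen m n} (hab : LWord.degree [a] + LWord.degree [b] = 0)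
    (h : LWord.Dyck ε (u ++ a :: b :: v)) (δ : Prop) [Decidable δ] (s : Finset ι)
    (c d : ι → LGen m n) (hc : ∀ k, LWord.degree [c k] = LWord.degree [a])
    (hd : ∀ k, LWord.degree [d k] = LWord.degree [b]) :
    wordToF K u * ((if δ then 1 else 0) -
      ∑ k ∈ s, FreeAlgebra.ι K (c k) * FreeAlgebra.ι K (d k)) * wordToF K v
        ∈ spanDyck K m n ε := by
  rw [mul_sub, sub_mul, Finset.mul_sum, Finset.sum_mul]
  refine Submodule.sub_mem _ ?_ (Submodule.sum_mem _ fun k _ => ?_)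
  · split_ifs
    · exact Submodule.subset_span ⟨u ++ v, h.remove_pair hab, by simp [wordToF]⟩
    · simp
  · exact Submodule.subset_span ⟨u ++ c k :: d k :: v, h.replace_pair (hc k) (hd k),
      by simp [wordToF, mul_assoc]⟩

theorem fRedX_mem_spanDyck (K : Type) [Field K] {m n : ℕ} {ε : ℤ} {u v : LWord m n}
    {i i' : Fin m} {j : Fin n}
    (h : LWord.Dyck ε (u ++ Sum.inl (i, j) :: Sum.inr (j, i') :: v)) :
    wordToF K u * fRedX K i i' * wordToF K v ∈ spanDyck K m n ε :=
  reduction_mem_spanDyck K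
    (by rw [LWord.degree_singleton_inl, LWord.degree_singleton_inr]; rfl) h (i = i') _
    (fun k => Sum.inl (i, k)) (fun k => Sum.inr (k, i'))
    (fun _ => by simp only [LWord.degree_singleton_inl])
    (fun _ => by simp only [LWord.degree_singleton_inr])

theorem fRedY_mem_spanDyck (K : Type) [Field K] {m n : ℕ} {ε : ℤ} {u v : LWord m n}
    {j j' : Fin n} {i : Fin m}
    (h : LWord.Dyck ε (u ++ Sum.inr (j, i) :: Sum.inl (i, j') :: v)) :
    wordToF K u * fRedY K j j' * wordToF K v ∈ spanDyck K m n ε :=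
  reduction_mem_spanDyck K
    (by rw [LWord.degree_singleton_inl, LWord.degree_singleton_inr]; rfl) h (j = j') _
    (fun k => Sum.inr (j, k)) (fun k => Sum.inl (k, j'))
    (fun _ => by simp only [LWord.degree_singleton_inr])
    (fun _ => by simp only [LWord.degree_singleton_inl])

/-- `K⟨X⟩₀^{xy}` and `K⟨X⟩₀^{yx}` are closed under the reductions of the
system `S`: replacing a forbidden subword `x_{in} y_{ni'}` (resp. `y_{jm} x_{mj'}`) by its
reduction `f_σ` inside a word of `⟨X⟩₀^{xy}` (resp. `⟨X⟩₀^{yx}`) yields a `K`-linear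
combination of words of `⟨X⟩₀^{xy}` (resp. `⟨X⟩₀^{yx}`). -/
theorem stmt7 (K : Type) [Field K] (m n : ℕ) (hm : 0 < m) (hn : 0 < n) :
    (∀ (u v : LWord m n) (i i' : Fin m) (j : Fin n), (j : ℕ) = n - 1 →
      LWord.InXY (u ++ Sum.inl (i, j) :: Sum.inr (j, i') :: v) →
      wordToF K u * fRedX K i i' * wordToF K v ∈ spanXYF K m n) ∧
    (∀ (u v : LWord m n) (j j' : Fin n) (i : Fin m), (i : ℕ) = m - 1 →
      LWord.InXY (u ++ Sum.inr (j, i) :: Sum.inl (i, j') :: v) →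
      wordToF K u * fRedY K j j' * wordToF K v ∈ spanXYF K m n) ∧
    (∀ (u v : LWord m n) (i i' : Fin m) (j : Fin n), (j : ℕ) = n - 1 →
      LWord.InYX (u ++ Sum.inl (i, j) :: Sum.inr (j, i') :: v) →
      wordToF K u * fRedX K i i' * wordToF K v ∈ spanYXF K m n) ∧
    (∀ (u v : LWord m n) (j j' : Fin n) (i : Fin m), (i : ℕ) = m - 1 →
      LWord.InYX (u ++ Sum.inr (j, i) :: Sum.inl (i, j') :: v) →
      wordToF K u * fRedY K j j' * wordToF K v ∈ spanYXF K m n) := by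
  simp only [LWord.inXY_iff_dyck, LWord.inYX_iff_dyck, spanXYF_eq_spanDyck, spanYXF_eq_spanDyck]
  exact ⟨fun _ _ _ _ _ _ h => fRedX_mem_spanDyck K h, fun _ _ _ _ _ _ h => fRedY_mem_spanDyck K h,
    fun _ _ _ _ _ _ h => fRedX_mem_spanDyck K h, fun _ _ _ _ _ _ h => fRedY_mem_spanDyck K h⟩
end
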